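/- arXiv:1009.0579 — 3 statements merged into one kernel-verified Lean document; each statement's English description precedes it below -/
import Mathlib

section
/- Let G be a finite simple graph that is 2k-regular (every vertex has degree exactly 2k) for some natural number k. Then the edge set of G can be partitioned into k classes such that each class is the edge set of a spanning 2-regular subgraph of G (i.e., every vertex of G is incident to exactly 2 edges of each class). -/
open Finset in
/-- A family of finite sets of size at least `d > 0`, in which every point is covered at most
`d` times, has a system of distinct representatives. -/
theorem exists_injective_mem_of_card_le {ι α : Type*} [Fintype ι] [DecidableEq α]
    {d : ℕ} (hd : 0 < d) (t : ι → Finset α) (hrow : ∀ i, d ≤ #(t i))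
    (hcol : ∀ a, #{i | a ∈ t i} ≤ d) :
    ∃ f : ι → α, Function.Injective f ∧ ∀ i, f i ∈ t i := by
  classical
  refine (all_card_le_biUnion_card_iff_exists_injective t).1 fun s => ?_
  refine Nat.le_of_mul_le_mul_right ?_ hd
  refine card_mul_le_card_mul (fun i a => a ∈ t i) (fun i hi => ?_) (fun a _ => ?_)
  · refine (hrow i).trans (card_le_card fun a ha => ?_)
    exact (mem_bipartiteAbove _).2 ⟨mem_biUnion.2 ⟨i, hi, ha⟩, ha⟩
  · refine le_trans (card_le_card fun i hi => ?_) (hcol a)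
    simpa using ((mem_bipartiteBelow _).1 hi).2

open Finset in
/-- A finite `k`-regular relation is the disjoint union of the graphs of `k` permutations. -/
theorem exists_perm_decomposition {V : Type*} [Fintype V] [DecidableEq V] (k : ℕ)
    (t : V → Finset V) (hrow : ∀ v, #(t v) = k) (hcol : ∀ a, #{v | a ∈ t v} = k) :
    ∃ σ : Fin k → Equiv.Perm V, (∀ v, Function.Injective fun i => σ i v) ∧
      ∀ v a, a ∈ t v ↔ ∃ i, σ i v = a := by
  induction k generalizing t with
  | zero =>
    refine ⟨fun _ => 1, fun v => Function.injective_of_subsingleton _, fun v a => ?_⟩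
    simp [card_eq_zero.1 (hrow v)]
  | succ k ih =>
    obtain ⟨f, hf, hft⟩ := exists_injective_mem_of_card_le k.succ_pos t
      (fun v => (hrow v).ge) (fun a => (hcol a).le)
    let e : Equiv.Perm V := Equiv.ofBijective f (Finite.injective_iff_bijective.1 hf)
    have he : ∀ v, e v = f v := fun _ => rfl
    obtain ⟨σ, hinj, hσ⟩ := ih (fun v => (t v).erase (e v))
      (fun v => by simp [card_erase_of_mem (hft v), he, hrow])
      (fun a => by
        have h : ({v | a ∈ (t v).erase (e v)} : Finset V)
            = ({v | a ∈ t v} : Finset V).erase (e.symm a) := by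
          ext v
          simp [Equiv.eq_symm_apply, eq_comm]
        rw [h, card_erase_of_mem, hcol, Nat.add_sub_cancel]
        simpa [← he] using hft (e.symm a))
    have hne : ∀ v i, σ i v ≠ e v := fun v i =>
      (mem_erase.1 ((hσ v _).2 ⟨i, rfl⟩)).1
    refine ⟨Fin.cons e σ, fun v i j => ?_, fun v a => ?_⟩
    · refine Fin.cases ?_ (fun i => ?_) i <;> refine Fin.cases ?_ (fun j => ?_) j
      · simp
      · exact fun h => absurd h.symm (hne v j)
      · exact fun h => absurd h (hne v i)
      · exact fun h => congrArg Fin.succ (hinj v h)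
    · rw [Fin.exists_fin_succ]
      simp only [Fin.cons_zero, Fin.cons_succ, ← hσ, mem_erase]
      by_cases h : e v = a
      · simpa [h] using h ▸ hft v
      · simp [h, Ne.symm h]

open Finset in
/-- A finite `2k`-regular graph has an orientation with all in- and out-degrees equal to `k`.
The set of heads of arcs with tail `v` is `t v`. -/
theorem SimpleGraph.IsRegularOfDegree.exists_orientation {V : Type*} [Fintype V] [DecidableEq V]
    {G : SimpleGraph V} [DecidableRel G.Adj] {k : ℕ} (hreg : G.IsRegularOfDegree (2 * k)) :
    ∃ t : V → Finset V, (∀ u v, G.Adj u v ↔ v ∈ t u ∨ u ∈ t v) ∧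
      (∀ u v, v ∈ t u → u ∉ t v) ∧ (∀ v, #(t v) = k) ∧ ∀ a, #{v | a ∈ t v} = k := by
  classical
  rcases k.eq_zero_or_pos with rfl | hk
  · refine ⟨fun _ => ∅, fun u v => ?_, by simp, by simp, by simp⟩
    have h : #(G.neighborFinset u) = 0 := hreg u
    simpa using fun huv => notMem_empty v (card_eq_zero.1 h ▸ (G.mem_neighborFinset u v).2 huv)
  obtain ⟨f, hf, hfe⟩ := exists_injective_mem_of_card_le (d := 2 * k) (by lia)
    (fun e : G.edgeSet => ({p | p.1 ∈ e.1} : Finset (V × Fin k)))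
    (by
      rintro ⟨e, he⟩
      induction e with | _ u v
      have h : ({p | p.1 ∈ s(u, v)} : Finset (V × Fin k)) = ({u, v} : Finset V) ×ˢ univ := by
        ext; simp
      rw [h, card_product, card_pair (G.ne_of_adj he), card_univ, Fintype.card_fin])
    (fun p => by
      rw [← hreg p.1, ← G.card_incidenceFinset_eq_degree]
      refine card_le_card_of_injOn Subtype.val (fun e he => ?_) Subtype.val_injective.injOn
      simpa [SimpleGraph.mem_incidenceFinset, SimpleGraph.incidenceSet] using he)
  simp only [mem_filter_univ] at hfe
  let t : V → Finset V := fun u => {v | ∃ h : G.Adj u v, (f ⟨s(u, v), h⟩).1 = v}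
  have ht : ∀ u v, v ∈ t u ↔ ∃ h : G.Adj u v, (f ⟨s(u, v), h⟩).1 = v := by simp [t]
  have hswap : ∀ u v (h : G.Adj u v), f ⟨s(v, u), h.symm⟩ = f ⟨s(u, v), h⟩ := fun u v h =>
    congrArg f (Subtype.ext Sym2.eq_swap)
  have hadj : ∀ u v, G.Adj u v ↔ v ∈ t u ∨ u ∈ t v := by
    intro u v
    rw [ht, ht]
    refine ⟨fun h => ?_, ?_⟩
    · rcases Sym2.mem_iff.1 (hfe ⟨s(u, v), h⟩) with h' | h'
      · exact .inr ⟨h.symm, by rw [hswap u v h, h']⟩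
      · exact .inl ⟨h, h'⟩
    · rintro (⟨h, -⟩ | ⟨h, -⟩)
      exacts [h, h.symm]
  have hasymm : ∀ u v, v ∈ t u → u ∉ t v := by
    intro u v huv hvu
    obtain ⟨h, h₁⟩ := (ht u v).1 huv
    obtain ⟨_, h₂⟩ := (ht v u).1 hvu
    rw [hswap u v h, h₁] at h₂
    exact h.ne h₂.symm
  have hin : ∀ a, #{v | a ∈ t v} ≤ k := by
    intro a
    let g : V → V × Fin k := fun v => if h : G.Adj v a then f ⟨s(v, a), h⟩ else (v, ⟨0, hk⟩)
    have hg : ∀ v (h : G.Adj v a), g v = f ⟨s(v, a), h⟩ := fun v h => dif_pos h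
    have := card_le_card_of_injOn (s := ({v | a ∈ t v} : Finset V))
      (t := ({a} : Finset V) ×ˢ (univ : Finset (Fin k))) g
      (fun v hv => by
        obtain ⟨h, h'⟩ := (ht v a).1 (by simpa using hv)
        simpa [hg v h, Prod.ext_iff] using h'.symm)
      (fun v hv w hw hvw => by
        obtain ⟨h, -⟩ := (ht v a).1 (by simpa using hv)
        obtain ⟨h', -⟩ := (ht w a).1 (by simpa using hw)
        rw [hg v h, hg w h'] at hvw
        exact Sym2.congr_left.1 (congrArg Subtype.val (hf hvw)))
    simpa using this
  have hdeg : ∀ v, #(t v) + #{u | v ∈ t u} = 2 * k := by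
    intro v
    rw [← hreg v, ← G.card_neighborFinset_eq_degree, ← card_union_of_disjoint]
    · congr 1
      ext u
      simp [hadj v u]
    · exact Finset.disjoint_left.2 fun u hu hu' => hasymm v u hu (by simpa using hu')
  have hsum : ∑ v, #(t v) = ∑ v, #{u | v ∈ t u} := by
    simpa [bipartiteAbove, bipartiteBelow] using
      sum_card_bipartiteAbove_eq_sum_card_bipartiteBelow (s := univ) (t := univ)
        (fun u v => v ∈ t u)
  have hle : ∀ v ∈ univ, #{u | v ∈ t u} ≤ #(t v) := fun v _ => by
    have := hin v; have := hdeg v; lia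
  have heq := fun v => (sum_eq_sum_iff_of_le hle).1 hsum.symm v (mem_univ v)
  refine ⟨t, hadj, hasymm, fun v => ?_, fun v => ?_⟩ <;>
  · have := heq v; have := hdeg v; lia

/-- Petersen's 2-factorization theorem: every finite simple `2k`-regular graph has a
partition of its edge set into `k` classes, each of which is the edge set of a spanning
2-regular subgraph. -/
theorem petersen_two_factorization {V : Type*} [Fintype V] (G : SimpleGraph V)
    [DecidableRel G.Adj] (k : ℕ) (hreg : G.IsRegularOfDegree (2 * k)) :
    ∃ H : Fin k → SimpleGraph V,
      (∀ i, H i ≤ G) ∧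
      (∀ i j, i ≠ j → Disjoint ((H i).edgeSet) ((H j).edgeSet)) ∧
      (⋃ i, (H i).edgeSet) = G.edgeSet ∧
      (∀ i v, ((H i).neighborSet v).ncard = 2) := by
  classical
  obtain ⟨t, hadj, hasymm, hout, hin⟩ := hreg.exists_orientation
  obtain ⟨σ, hinj, hσ⟩ := exists_perm_decomposition k t hout hin
  have hmem : ∀ i v, σ i v ∈ t v := fun i v => (hσ v _).2 ⟨i, rfl⟩
  have hne : ∀ i j v, σ i (σ j v) ≠ v := fun i j v h =>
    hasymm v _ (hmem j v) ((hσ _ _).2 ⟨i, h⟩)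
  have hfix : ∀ i v, σ i v ≠ v := fun i v h => hne i i v (by rw [h, h])
  let H : Fin k → SimpleGraph V := fun i =>
    { Adj := fun u v => σ i u = v ∨ σ i v = u
      symm := ⟨fun _ _ h => h.symm⟩
      loopless := ⟨fun v h => hfix i v (or_self_iff.1 h)⟩ }
  have hH : ∀ i u v, (H i).Adj u v ↔ σ i u = v ∨ σ i v = u := fun _ _ _ => Iff.rfl
  refine ⟨H, fun i u v h => ?_, fun i j hij => ?_, ?_, fun i v => ?_⟩
  · rw [hadj, hσ, hσ]
    exact h.imp (fun h => ⟨i, h⟩) (fun h => ⟨i, h⟩)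
  · refine Set.disjoint_left.2 fun e => ?_
    induction e with | _ u v
    simp only [SimpleGraph.mem_edgeSet, hH]
    rintro (rfl | rfl) (h | h)
    · exact hij (hinj u h.symm)
    · exact hne _ _ _ h
    · exact hne _ _ _ h
    · exact hij (hinj v h.symm)
  · ext e
    induction e with | _ u v
    simp only [Set.mem_iUnion, SimpleGraph.mem_edgeSet, hH, hadj, hσ, exists_or]
  · have h : (H i).neighborSet v = {σ i v, (σ i).symm v} := by
      ext u
      simp [hH, Equiv.eq_symm_apply, eq_comm]
    rw [h, Set.ncard_pair]
    exact fun h => hne i i v (by rw [h, Equiv.apply_symm_apply])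
end

section
/- Let G be a finite simple 3-regular graph in which no edge is a bridge (removing any single edge does not disconnect its connected component). Then G has a perfect matching. -/
namespace SimpleGraph

variable {V : Type*} [Fintype V]

open scoped Classical in
/-- The darts of `G` leaving the vertex set `S`, as ordered pairs. -/
noncomputable def edgeBoundary (G : SimpleGraph V) (S : Set V) : Finset (V × V) :=
  {p | G.Adj p.1 p.2 ∧ p.1 ∈ S ∧ p.2 ∉ S}

lemma mem_edgeBoundary {G : SimpleGraph V} {S : Set V} {p : V × V} :
    p ∈ G.edgeBoundary S ↔ G.Adj p.1 p.2 ∧ p.1 ∈ S ∧ p.2 ∉ S := by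
  simp [edgeBoundary]

open scoped Classical in
lemma even_card_filter_adj_mem_mem (G : SimpleGraph V) (S : Set V) :
    Even (Finset.card {p : V × V | G.Adj p.1 p.2 ∧ p.1 ∈ S ∧ p.2 ∈ S}) := by
  rw [← ZMod.natCast_eq_zero_iff_even, Finset.card_eq_sum_ones, Nat.cast_sum]
  refine Finset.sum_involution (fun p _ ↦ p.swap) (fun _ _ ↦ by decide) ?_ ?_ (fun _ _ ↦ rfl)
  · rintro ⟨a, b⟩ h - heq
    simp only [Prod.swap_prod_mk, Prod.mk.injEq] at heq
    simp [heq.1] at h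
  · rintro ⟨a, b⟩ h
    simp only [Finset.mem_filter_univ, Prod.swap_prod_mk] at h ⊢
    exact ⟨h.1.symm, h.2.2, h.2.1⟩

open scoped Classical in
lemma IsRegularOfDegree.card_filter_adj_mem {G : SimpleGraph V} [DecidableRel G.Adj] {d : ℕ}
    (hreg : G.IsRegularOfDegree d) (S : Set V) :
    Finset.card {p : V × V | G.Adj p.1 p.2 ∧ p.1 ∈ S} = d * S.ncard := by
  have h : ({p : V × V | G.Adj p.1 p.2 ∧ p.1 ∈ S} : Finset (V × V)).card =
      ∑ a ∈ S.toFinset, (G.neighborFinset a).card := by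
    rw [← Finset.card_sigma]
    refine Finset.card_bij' (fun p _ ↦ ⟨p.1, p.2⟩) (fun p _ ↦ (p.1, p.2)) ?_ ?_ ?_ ?_ <;>
      simp +contextual
  rw [h, Finset.sum_congr rfl fun a _ ↦ (G.card_neighborFinset_eq_degree a).trans (hreg a),
    Finset.sum_const, Set.ncard_eq_toFinset_card', smul_eq_mul, mul_comm]

lemma IsRegularOfDegree.odd_card_edgeBoundary {G : SimpleGraph V} [DecidableRel G.Adj] {d : ℕ}
    (hreg : G.IsRegularOfDegree d) (hd : Odd d) {S : Set V} (hS : Odd S.ncard) :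
    Odd (G.edgeBoundary S).card := by
  classical
  have hsplit := hreg.card_filter_adj_mem S
  rw [← Finset.card_filter_add_card_filter_not (fun p : V × V ↦ p.2 ∈ S), Finset.filter_filter,
    Finset.filter_filter] at hsplit
  simp only [and_assoc] at hsplit
  have hodd := hd.mul hS
  rw [← hsplit, Nat.odd_add'] at hodd
  have hb : (G.edgeBoundary S).card =
      Finset.card {p : V × V | G.Adj p.1 p.2 ∧ p.1 ∈ S ∧ p.2 ∉ S} := by
    congr 1
    ext
    simp [mem_edgeBoundary]
  rw [hb]
  refine hodd.2 ?_
  convert G.even_card_filter_adj_mem_mem S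

lemma isBridge_of_edgeBoundary_eq_singleton {G : SimpleGraph V} {S : Set V} {a b : V}
    (h : G.edgeBoundary S = {(a, b)}) : G.IsBridge s(a, b) := by
  have hab : (a, b) ∈ G.edgeBoundary S := by simp [h]
  rw [mem_edgeBoundary] at hab
  rw [isBridge_iff]
  rintro ⟨w⟩
  have closed : ∀ {x y : V}, (G.deleteEdges {s(a, b)}).Walk x y → x ∈ S → y ∈ S := by
    intro x y w
    induction w with
    | nil => exact id
    | @cons x z _ hxz _ ih =>
      intro hx
      refine ih (by_contra fun hz ↦ ?_)
      rw [deleteEdges_adj] at hxz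
      have hmem : (x, z) ∈ G.edgeBoundary S := mem_edgeBoundary.2 ⟨hxz.1, hx, hz⟩
      rw [h, Finset.mem_singleton, Prod.mk.injEq] at hmem
      exact hxz.2 (by simp [hmem.1, hmem.2])
  exact hab.2.2 (closed w hab.2.1)

lemma IsRegularOfDegree.three_le_card_edgeBoundary {G : SimpleGraph V} [DecidableRel G.Adj]
    {d : ℕ} (hreg : G.IsRegularOfDegree d) (hd : Odd d)
    (hbridgeless : ∀ e ∈ G.edgeSet, ¬ G.IsBridge e) {S : Set V} (hS : Odd S.ncard) :
    3 ≤ (G.edgeBoundary S).card := by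
  have hodd := hreg.odd_card_edgeBoundary hd hS
  have hne : (G.edgeBoundary S).card ≠ 1 := by
    intro h
    obtain ⟨⟨a, b⟩, hab⟩ := Finset.card_eq_one.1 h
    have hmem : (a, b) ∈ G.edgeBoundary S := by simp [hab]
    exact hbridgeless s(a, b) (mem_edgeBoundary.1 hmem).1
      (isBridge_of_edgeBoundary_eq_singleton hab)
  obtain ⟨k, hk⟩ := hodd
  lia

lemma mem_of_mem_edgeBoundary_supp {G : SimpleGraph V} {u : Set V}
    (c : ((⊤ : G.Subgraph).deleteVerts u).coe.ConnectedComponent) {p : V × V}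
    (hp : p ∈ G.edgeBoundary (Subtype.val '' c.supp)) : p.2 ∈ u := by
  obtain ⟨hadj, ⟨x, hx, hxp⟩, hp₂⟩ := mem_edgeBoundary.1 hp
  by_contra hu
  have hxu := x.2
  simp only [Subgraph.deleteVerts_verts, Subgraph.verts_top, Set.mem_sdiff] at hxu
  refine hp₂ ⟨⟨p.2, by simpa using hu⟩, ?_, rfl⟩
  refine c.mem_supp_of_adj_mem_supp hx ?_
  simp only [Subgraph.coe_adj, Subgraph.deleteVerts_adj, Subgraph.verts_top, Set.mem_univ,
    Subgraph.top_adj, true_and]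
  exact ⟨hxu.2, hu, hxp ▸ hadj⟩

end SimpleGraph

/-- Petersen's matching theorem: every finite simple 3-regular bridgeless graph has a
perfect matching. -/
theorem petersen_matching {V : Type*} [Fintype V] (G : SimpleGraph V)
    [DecidableRel G.Adj] (hreg : G.IsRegularOfDegree 3)
    (hbridgeless : ∀ e ∈ G.edgeSet, ¬ G.IsBridge e) :
    ∃ M : G.Subgraph, M.IsPerfectMatching := by
  classical
  rw [SimpleGraph.tutte]
  intro u hu
  rw [SimpleGraph.IsTutteViolator,
    Set.ncard_eq_toFinset_card' (SimpleGraph.oddComponents _)] at hu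
  set O := ((⊤ : G.Subgraph).deleteVerts u).coe.oddComponents.toFinset with hO
  have hdisj : (O : Set ((⊤ : G.Subgraph).deleteVerts u).coe.ConnectedComponent).PairwiseDisjoint
      fun c ↦ G.edgeBoundary (Subtype.val '' c.supp) := by
    intro c _ d _ hcd
    refine Finset.disjoint_left.2 fun p hc hd ↦ hcd ?_
    obtain ⟨-, ⟨x, hx, hxp⟩, -⟩ := SimpleGraph.mem_edgeBoundary.1 hc
    obtain ⟨-, ⟨y, hy, hyp⟩, -⟩ := SimpleGraph.mem_edgeBoundary.1 hd
    obtain rfl : x = y := Subtype.ext (hxp.trans hyp.symm)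
    exact hx.symm.trans hy
  have hlower : O.card * 3 ≤
      (O.biUnion fun c ↦ G.edgeBoundary (Subtype.val '' c.supp)).card := by
    rw [Finset.card_biUnion hdisj, ← smul_eq_mul]
    refine Finset.card_nsmul_le_sum _ _ _ fun c hc ↦ ?_
    refine hreg.three_le_card_edgeBoundary (by decide) hbridgeless ?_
    rw [Set.ncard_image_of_injective _ Subtype.val_injective]
    simpa [hO] using hc
  have hupper : (O.biUnion fun c ↦ G.edgeBoundary (Subtype.val '' c.supp)).card ≤
      3 * u.ncard := by
    rw [← hreg.card_filter_adj_mem u]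
    refine Finset.card_le_card_of_injOn Prod.swap ?_ Prod.swap_injective.injOn
    intro p hp
    obtain ⟨c, -, hc⟩ := Finset.mem_biUnion.1 hp
    simpa using ⟨(SimpleGraph.mem_edgeBoundary.1 hc).1.symm,
      SimpleGraph.mem_of_mem_edgeBoundary_supp c hc⟩
  lia
end

section
/- Let V be a two-dimensional oriented real inner product space (the oriented Euclidean plane). Let o, p, q, r, a, b be points of V with p ≠ q, p ≠ r, q ≠ r, o ≠ p, and dist o p = dist o q = dist o r, dist a p = dist a r, dist b q = dist b r. Then the oriented angles satisfy (2 : ℤ) • ∡ a r b = (2 : ℤ) • ∡ b q o − (2 : ℤ) • ∡ a p o. -/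
open EuclideanGeometry

/-- If `a` and `o` are each equidistant from `p` and `r`, then the oriented angles from `a` to `o`
at `r` and at `p` are opposite. -/
theorem oangle_eq_neg_oangle_of_dist_eq {V P : Type*} [NormedAddCommGroup V]
    [InnerProductSpace ℝ V] [MetricSpace P] [NormedAddTorsor V P]
    [Fact (Module.finrank ℝ V = 2)] [Module.Oriented ℝ V (Fin 2)]
    {a o p r : P} (hpr : p ≠ r) (har : a ≠ r) (hor : o ≠ r)
    (ha : dist a p = dist a r) (ho : dist o p = dist o r) :
    ∡ a r o = -∡ a p o := by
  have hap : a ≠ p := dist_ne_zero.mp (ha ▸ dist_ne_zero.mpr har)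
  have hop : o ≠ p := dist_ne_zero.mp (ho ▸ dist_ne_zero.mpr hor)
  rw [← oangle_add har hpr hor, ← oangle_add hap hpr.symm hop, oangle_rev p r a,
    ← oangle_eq_oangle_of_dist_eq ha, ← oangle_eq_oangle_of_dist_eq ho, oangle_rev o p r,
    neg_add, neg_neg]

/-- Property 2 of the paper (directed-angle form): let `p`, `q`, `r` lie on a circle
centered at `o`, let `a` be the center of a circle through `p` and `r`, and let `b` be the
center of a circle through `q` and `r`. Then twice the oriented angle `∡ a r b` (which
encodes the directed angle at which the two circles meet at `r`) equals
`2 • ∡ b q o - 2 • ∡ a p o`, independently of the position of `r` on the circle around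
`o`. -/
theorem meeting_angle_locus_circle {V : Type*} [NormedAddCommGroup V]
    [InnerProductSpace ℝ V] [Fact (Module.finrank ℝ V = 2)]
    [Module.Oriented ℝ V (Fin 2)]
    (o p q r a b : V) (hpq : p ≠ q) (hpr : p ≠ r) (hqr : q ≠ r) (hop : o ≠ p)
    (h₁ : dist o p = dist o q) (h₂ : dist o p = dist o r)
    (h₃ : dist a p = dist a r) (h₄ : dist b q = dist b r) :
    (2 : ℤ) • ∡ a r b = (2 : ℤ) • ∡ b q o - (2 : ℤ) • ∡ a p o := by
  have hor : o ≠ r := by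
    rintro rfl
    exact hop (dist_eq_zero.mp (h₂.trans (dist_self o)))
  have har : a ≠ r := by
    rintro rfl
    exact hpr (dist_eq_zero.mp (h₃.trans (dist_self a))).symm
  have hbr : b ≠ r := by
    rintro rfl
    exact hqr (dist_eq_zero.mp (h₄.trans (dist_self b))).symm
  have ha := oangle_eq_neg_oangle_of_dist_eq hpr har hor h₃ h₂
  have hb := oangle_eq_neg_oangle_of_dist_eq hqr hbr hor h₄ (h₁.symm.trans h₂)
  rw [← zsmul_sub, ← oangle_add har hor hbr, ha, oangle_rev b r o, hb, neg_neg, neg_add_eq_sub]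
end
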